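/- arXiv:2006.16576 — 3 statements merged into one kernel-verified Lean document; each statement's English description precedes it below -/
import Mathlib

section
/- Let n ≥ 4, let R = {±(e_i − e_j) : 1 ≤ i < j ≤ n} ⊂ ℝⁿ (a root system of type A_{n−1}, with e_1,…,e_n the standard basis) and β = e_2 − e_1. Then q(β) = 2, i.e. there is an admissible sequence of length 2 for β but none of length 3. -/
/-- `α` is an admissible sequence for `β`: each `αᵢ ∈ R`, `αᵢ + αⱼ ∉ R ∪ {0}` for
`i ≠ j`, and `β` plus any nonempty subset-sum of the `αᵢ` lies in `R`. -/
def IsAdmissible {V : Type*} [AddCommGroup V] (R : Set V) (β : V) {k : ℕ}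
    (α : Fin k → V) : Prop :=
  (∀ i, α i ∈ R) ∧
    (∀ i j : Fin k, i ≠ j → α i + α j ∉ R ∧ α i + α j ≠ 0) ∧
    ∀ s : Finset (Fin k), s.Nonempty → β + ∑ i ∈ s, α i ∈ R

/-- The standard basis vector `eᵢ` of `ℝⁿ`. -/
noncomputable def e (n : ℕ) (i : Fin n) : EuclideanSpace ℝ (Fin n) :=
  EuclideanSpace.single i 1

/-- The root system of type `A_{n−1}`: `{±(eᵢ − eⱼ) : 1 ≤ i < j ≤ n}`. -/
def RootA (n : ℕ) : Set (EuclideanSpace ℝ (Fin n)) :=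
  {v | ∃ i j : Fin n, i ≠ j ∧ v = e n i - e n j}

theorem e_apply (n : ℕ) (i k : Fin n) : e n i k = if k = i then 1 else 0 := by
  simp [e]

theorem RootA.exists_apply {n : ℕ} {v : EuclideanSpace ℝ (Fin n)} (hv : v ∈ RootA n) :
    ∃ i j : Fin n, i ≠ j ∧
      ∀ k, v k = (if k = i then (1 : ℝ) else 0) - if k = j then 1 else 0 := by
  obtain ⟨i, j, hij, rfl⟩ := hv
  exact ⟨i, j, hij, fun k => by simp [e_apply]⟩

/-- A vector with two equal coordinates of absolute value one is not a root of type `A`. -/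
theorem RootA.notMem_of_apply_eq {n : ℕ} {v : EuclideanSpace ℝ (Fin n)} {p q : Fin n}
    (hpq : p ≠ q) (h : v p = 1 ∧ v q = 1 ∨ v p = -1 ∧ v q = -1) : v ∉ RootA n := by
  intro hv
  obtain ⟨i, j, hij, hk⟩ := RootA.exists_apply hv
  beta_reduce at h hk
  have hp := hk p
  have hq := hk q
  grind

/-- A root of type `A` whose sum with the root `e p - e q` is a root is either of the form
`e q - e k` or of the form `e k - e p`, with `k` different from `p` and `q`. -/
theorem RootA.apply_of_add_mem {n : ℕ} {p q : Fin n} (hpq : p ≠ q)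
    {v : EuclideanSpace ℝ (Fin n)} (hv : v ∈ RootA n) (h : e n p - e n q + v ∈ RootA n) :
    v q = 1 ∧ v p = 0 ∨ v q = 0 ∧ v p = -1 := by
  obtain ⟨a, b, hab, hk⟩ := RootA.exists_apply hv
  obtain ⟨c, d, hcd, hl⟩ := RootA.exists_apply h
  simp only [PiLp.add_apply, PiLp.sub_apply, e_apply, hk] at hl
  beta_reduce at hl hk ⊢
  have hp := hl p
  have hq := hl q
  have ha := hl a
  have hb := hl b
  have hc := hl c
  rw [hk p, hk q]
  grind

/-- Two distinct members of an admissible sequence for `e p - e q` in type `A` take different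
values at the coordinate `q`. -/
theorem IsAdmissible.apply_ne {n k : ℕ} {p q : Fin n} (hpq : p ≠ q)
    {α : Fin k → EuclideanSpace ℝ (Fin n)} (h : IsAdmissible (RootA n) (e n p - e n q) α)
    {i j : Fin k} (hij : i ≠ j) : α i q ≠ α j q := by
  intro heq
  obtain ⟨hR, -, hsum⟩ := h
  have key (i : Fin k) := RootA.apply_of_add_mem hpq (hR i)
    (by simpa using hsum {i} (Finset.singleton_nonempty i))
  have hs := hsum {i, j} (Finset.insert_nonempty _ _)
  rw [Finset.sum_pair hij] at hs
  refine RootA.notMem_of_apply_eq hpq ?_ hs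
  simp only [PiLp.add_apply, PiLp.sub_apply, e_apply, if_neg hpq, if_neg hpq.symm, if_true]
  have hi := key i
  have hj := key j
  beta_reduce at hi hj heq ⊢
  grind

theorem isAdmissible_pair {n : ℕ} {p q r s : Fin n} (hpq : p ≠ q) (hpr : p ≠ r) (hps : p ≠ s)
    (hqr : q ≠ r) (hqs : q ≠ s) (hrs : r ≠ s) :
    IsAdmissible (RootA n) (e n p - e n q) ![e n q - e n r, e n s - e n p] := by
  have hnot : e n q - e n r + (e n s - e n p) ∉ RootA n :=
    RootA.notMem_of_apply_eq hqs (by simp [e_apply, *, Ne.symm])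
  have hne : e n q - e n r + (e n s - e n p) ≠ 0 := fun h => by
    have := congrArg (fun v : EuclideanSpace ℝ (Fin n) => v q) h
    simp [e_apply, hpq.symm, hqr, hqs] at this
  refine ⟨?_, ?_, ?_⟩
  · rw [Fin.forall_fin_two]
    exact ⟨⟨q, r, hqr, rfl⟩, ⟨s, p, hps.symm, rfl⟩⟩
  · intro i j hij
    fin_cases i <;> fin_cases j
    · exact absurd rfl hij
    · exact ⟨hnot, hne⟩
    · simpa [add_comm] using And.intro hnot hne
    · exact absurd rfl hij
  · intro t ht
    rw [← Fintype.sum_ite_mem, Fin.sum_univ_two]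
    by_cases h0 : (0 : Fin 2) ∈ t <;> by_cases h1 : (1 : Fin 2) ∈ t
    · exact ⟨s, r, hrs.symm, by
        simp only [h0, h1, if_true, Matrix.cons_val_zero, Matrix.cons_val_one]
        abel⟩
    · exact ⟨p, r, hpr, by simp [h0, h1]⟩
    · exact ⟨s, q, hqs.symm, by simp [h0, h1]⟩
    · obtain ⟨x, hx⟩ := ht
      fin_cases x <;> contradiction

/-- For `n ≥ 4`, in the root system of type `A_{n−1}` the root `β = e₂ − e₁` has
`q(β) = 2`: there is an admissible sequence of length `2` for `β` but none of
length `3`. -/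
theorem aN_q_eq_two (n : ℕ) (hn : 4 ≤ n) :
    (∃ α : Fin 2 → EuclideanSpace ℝ (Fin n),
        IsAdmissible (RootA n) (e n ⟨1, by omega⟩ - e n ⟨0, by omega⟩) α) ∧
      ¬ ∃ α : Fin 3 → EuclideanSpace ℝ (Fin n),
        IsAdmissible (RootA n) (e n ⟨1, by omega⟩ - e n ⟨0, by omega⟩) α := by
  refine ⟨⟨_, isAdmissible_pair (r := ⟨2, by omega⟩) (s := ⟨3, by omega⟩)
    (by simp) (by simp) (by simp) (by simp) (by simp) (by simp)⟩, ?_⟩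
  rintro ⟨α, h⟩
  have hpq : (⟨1, by omega⟩ : Fin n) ≠ ⟨0, by omega⟩ := by simp
  have key (i : Fin 3) := RootA.apply_of_add_mem hpq (h.1 i)
    (by simpa using h.2.2 {i} (Finset.singleton_nonempty i))
  have h01 := h.apply_ne hpq (show (0 : Fin 3) ≠ 1 by decide)
  have h02 := h.apply_ne hpq (show (0 : Fin 3) ≠ 2 by decide)
  have h12 := h.apply_ne hpq (show (1 : Fin 3) ≠ 2 by decide)
  have k0 := key 0
  have k1 := key 1
  have k2 := key 2
  grind
end

section
/- Let n ≥ 3, let R = {±e_i : 1 ≤ i ≤ n} ∪ {±e_i ± e_j : 1 ≤ i < j ≤ n} ⊂ ℝⁿ (a root system of type B_n, with e_1,…,e_n the standard basis) and β = −e_1 (a short root). Then q(β) = 3, i.e. there is an admissible sequence of length 3 for β but none of length 4. -/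
/-- The root system of type `B_n`:
`{±eᵢ : 1 ≤ i ≤ n} ∪ {±eᵢ ± eⱼ : 1 ≤ i < j ≤ n}`. -/
def RootB (n : ℕ) : Set (EuclideanSpace ℝ (Fin n)) :=
  {v | (∃ i : Fin n, v = e n i ∨ v = -e n i) ∨
    ∃ i j : Fin n, i ≠ j ∧
      (v = e n i + e n j ∨ v = -(e n i + e n j) ∨ v = e n i - e n j)}

open InnerProductSpace in
lemma inner_e (n : ℕ) (i j : Fin n) : ⟪e n i, e n j⟫_ℝ = if i = j then 1 else 0 := by
  simp [e, EuclideanSpace.inner_single_left]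

namespace RootB

open InnerProductSpace

variable {n : ℕ} {u v : EuclideanSpace ℝ (Fin n)}

lemma e_mem (i : Fin n) : e n i ∈ RootB n := Or.inl ⟨i, Or.inl rfl⟩

lemma add_mem {i j : Fin n} (h : i ≠ j) : e n i + e n j ∈ RootB n :=
  Or.inr ⟨i, j, h, Or.inl rfl⟩

lemma sub_mem {i j : Fin n} (h : i ≠ j) : e n i - e n j ∈ RootB n :=
  Or.inr ⟨i, j, h, Or.inr (Or.inr rfl)⟩

lemma neg_mem (i : Fin n) : -e n i ∈ RootB n := Or.inl ⟨i, Or.inr rfl⟩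

lemma inner_self_eq (hv : v ∈ RootB n) : ⟪v, v⟫_ℝ = 1 ∨ ⟪v, v⟫_ℝ = 2 := by
  rcases hv with ⟨i, rfl | rfl⟩ | ⟨i, j, h, rfl | rfl | rfl⟩ <;>
    simp only [inner_add_left, inner_add_right, inner_sub_left, inner_sub_right, inner_neg_left,
      inner_neg_right, inner_e] <;> norm_num
  all_goals simp only [h, h.symm, if_false]; norm_num

lemma exists_int_apply (hv : v ∈ RootB n) (k : Fin n) : ∃ m : ℤ, v k = m := by
  have he (i : Fin n) : ∃ m : ℤ, e n i k = m := ⟨if k = i then 1 else 0, by simp [e]⟩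
  rcases hv with ⟨i, rfl | rfl⟩ | ⟨i, j, -, rfl | rfl | rfl⟩
  all_goals obtain ⟨a, ha⟩ := he i
  · exact ⟨a, ha⟩
  · exact ⟨-a, by simp [ha]⟩
  all_goals obtain ⟨b, hb⟩ := he j
  · exact ⟨a + b, by simp [ha, hb]⟩
  · exact ⟨-(a + b), by simp only [PiLp.add_apply, PiLp.neg_apply, ha, hb]; push_cast; rfl⟩
  · exact ⟨a - b, by simp [ha, hb]⟩

lemma exists_int_inner (hu : u ∈ RootB n) (hv : v ∈ RootB n) : ∃ m : ℤ, ⟪u, v⟫_ℝ = m := by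
  choose a ha using exists_int_apply hu
  choose b hb using exists_int_apply hv
  exact ⟨∑ k, b k * a k, by simp [PiLp.inner_apply, ha, hb]⟩

lemma inner_e_of_sub_mem {i : Fin n} (hv : v ∈ RootB n) (h : -e n i + v ∈ RootB n) :
    ⟪v, e n i⟫_ℝ = ⟪v, v⟫_ℝ - 1 := by
  obtain ⟨m, hm⟩ := exists_int_inner hv (e_mem i)
  have hd := inner_self_eq h
  simp only [inner_add_left, inner_add_right, inner_neg_left, inner_neg_right, inner_e, if_true,
    real_inner_comm v (e n i), hm] at hd ⊢
  rcases inner_self_eq hv with hs | hs <;> rw [hs] at hd ⊢ <;> norm_num at hd ⊢ <;>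
    norm_cast at hd ⊢ <;> omega

lemma inner_of_add_mem {i : Fin n} (hu : u ∈ RootB n) (hv : v ∈ RootB n)
    (hu' : -e n i + u ∈ RootB n) (hv' : -e n i + v ∈ RootB n)
    (h : -e n i + (u + v) ∈ RootB n) (heq : ⟪u, u⟫_ℝ = ⟪v, v⟫_ℝ) :
    ⟪u, v⟫_ℝ = ⟪u, u⟫_ℝ - 2 := by
  obtain ⟨m, hm⟩ := exists_int_inner hu hv
  have hd := inner_self_eq h
  simp only [inner_add_left, inner_add_right, inner_neg_left, inner_neg_right, inner_e, if_true,
    real_inner_comm v (e n i), real_inner_comm u (e n i), real_inner_comm u v,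
    inner_e_of_sub_mem hu hu', inner_e_of_sub_mem hv hv', hm, ← heq] at hd ⊢
  rcases inner_self_eq hu with hs | hs <;> rw [hs] at hd ⊢ <;> norm_num at hd ⊢ <;>
    norm_cast at hd ⊢ <;> omega

end RootB

namespace IsAdmissible

open InnerProductSpace

variable {n k : ℕ} {i : Fin n} {α : Fin k → EuclideanSpace ℝ (Fin n)}

lemma inner_eq (hα : IsAdmissible (RootB n) (-e n i) α) {a b : Fin k} (hab : a ≠ b)
    (heq : ⟪α a, α a⟫_ℝ = ⟪α b, α b⟫_ℝ) : ⟪α a, α b⟫_ℝ = ⟪α a, α a⟫_ℝ - 2 := by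
  obtain ⟨hR, -, hsum⟩ := hα
  have single (a : Fin k) : -e n i + α a ∈ RootB n := by simpa using hsum {a} (by simp)
  exact RootB.inner_of_add_mem (hR a) (hR b) (single a) (single b)
    (by simpa [Finset.sum_pair hab] using hsum {a, b} (by simp)) heq

lemma not_two_short (hα : IsAdmissible (RootB n) (-e n i) α) {a b : Fin k} (hab : a ≠ b) :
    ¬(⟪α a, α a⟫_ℝ = 1 ∧ ⟪α b, α b⟫_ℝ = 1) := by
  rintro ⟨ha, hb⟩
  refine (hα.2.1 a b hab).2 (inner_self_eq_zero (𝕜 := ℝ).1 ?_)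
  have h := hα.inner_eq hab (ha.trans hb.symm)
  simp only [inner_add_left, inner_add_right, real_inner_comm (α a) (α b), h, ha, hb]
  norm_num

lemma not_three_long (hα : IsAdmissible (RootB n) (-e n i) α) {a b c : Fin k} (hab : a ≠ b)
    (hac : a ≠ c) (hbc : b ≠ c) :
    ¬(⟪α a, α a⟫_ℝ = 2 ∧ ⟪α b, α b⟫_ℝ = 2 ∧ ⟪α c, α c⟫_ℝ = 2) := by
  rintro ⟨ha, hb, hc⟩
  have inner_e_eq (a : Fin k) : ⟪α a, e n i⟫_ℝ = ⟪α a, α a⟫_ℝ - 1 :=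
    RootB.inner_e_of_sub_mem (hα.1 a) (by simpa using hα.2.2 {a} (by simp))
  have h := real_inner_self_nonneg (x := α a + α b + α c - (3 : ℝ) • e n i)
  simp only [inner_add_left, inner_add_right, inner_sub_left, inner_sub_right,
    real_inner_smul_left, real_inner_smul_right, inner_e, if_true,
    real_inner_comm _ (e n i), real_inner_comm (α a) (α b), real_inner_comm (α a) (α c),
    real_inner_comm (α b) (α c), inner_e_eq, hα.inner_eq hab (ha.trans hb.symm),
    hα.inner_eq hac (ha.trans hc.symm), hα.inner_eq hbc (hb.trans hc.symm), ha, hb, hc] at h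
  norm_num at h

end IsAdmissible

open InnerProductSpace in
lemma isAdmissible_three {n : ℕ} {i j k : Fin n} (hij : i ≠ j) (hik : i ≠ k) (hjk : j ≠ k) :
    IsAdmissible (RootB n) (-e n i) ![e n i + e n j, e n i - e n j, e n k] := by
  refine ⟨?_, ?_, ?_⟩
  · intro a
    fin_cases a
    exacts [RootB.add_mem hij, RootB.sub_mem hij, RootB.e_mem k]
  · have hlong {u v : EuclideanSpace ℝ (Fin n)} (h : 2 < ⟪u + v, u + v⟫_ℝ) :
        u + v ∉ RootB n ∧ u + v ≠ 0 := by
      refine ⟨fun hm => ?_, fun h0 => ?_⟩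
      · rcases RootB.inner_self_eq hm with h' | h' <;> linarith
      · rw [h0, inner_zero_left] at h
        linarith
    intro a b hab
    apply hlong
    fin_cases a <;> fin_cases b <;> first
      | exact absurd rfl hab
      | simp only [Fin.zero_eta, Fin.mk_one, Fin.reduceFinMk, Matrix.cons_val, inner_add_left,
          inner_add_right, inner_sub_left, inner_sub_right, inner_e, hij, hik, hjk, hij.symm,
          hik.symm, hjk.symm, if_true, if_false]
        norm_num
  · intro s hs
    rw [← Finset.filter_univ_mem s, Finset.sum_filter, Fin.sum_univ_three]
    by_cases h0 : 0 ∈ s <;> by_cases h1 : 1 ∈ s <;> by_cases h2 : 2 ∈ s <;>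
      simp only [h0, h1, h2, if_true, if_false, Matrix.cons_val]
    · convert RootB.add_mem hik using 1
      abel
    · convert RootB.e_mem i using 1
      abel
    · convert RootB.add_mem hjk using 1
      abel
    · convert RootB.e_mem j using 1
      abel
    · convert RootB.sub_mem hjk.symm using 1
      abel
    · convert RootB.neg_mem j using 1
      abel
    · convert RootB.sub_mem hik.symm using 1
      abel
    · obtain ⟨a, ha⟩ := hs
      fin_cases a <;> contradiction

/-- For `n ≥ 3`, in the root system of type `B_n` the short root `β = −e₁` has
`q(β) = 3`: there is an admissible sequence of length `3` for `β` but none of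
length `4`. -/
theorem bN_q_eq_three (n : ℕ) (hn : 3 ≤ n) :
    (∃ α : Fin 3 → EuclideanSpace ℝ (Fin n),
        IsAdmissible (RootB n) (-e n ⟨0, by omega⟩) α) ∧
      ¬ ∃ α : Fin 4 → EuclideanSpace ℝ (Fin n),
        IsAdmissible (RootB n) (-e n ⟨0, by omega⟩) α := by
  refine ⟨⟨_, isAdmissible_three (j := ⟨1, by omega⟩) (k := ⟨2, by omega⟩)
    (by simp) (by simp) (by simp)⟩, ?_⟩
  rintro ⟨α, hα⟩
  have hlen (a : Fin 4) := RootB.inner_self_eq (hα.1 a)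
  obtain ⟨a, ha⟩ : ∃ a : Fin 4, ∀ b, b ≠ a → inner ℝ (α b) (α b) = 2 := by
    by_cases h : ∃ a, inner ℝ (α a) (α a) = 1
    · obtain ⟨a, ha⟩ := h
      exact ⟨a, fun b hb => (hlen b).resolve_left fun h => hα.not_two_short hb ⟨h, ha⟩⟩
    · exact ⟨0, fun b _ => (hlen b).resolve_left fun hb => h ⟨b, hb⟩⟩
  have hne : a + 1 ≠ a ∧ a + 2 ≠ a ∧ a + 3 ≠ a ∧ a + 1 ≠ a + 2 ∧ a + 1 ≠ a + 3 ∧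
      a + 2 ≠ a + 3 := by
    clear ha
    decide +revert
  obtain ⟨h1, h2, h3, h12, h13, h23⟩ := hne
  exact hα.not_three_long h12 h13 h23 ⟨ha _ h1, ha _ h2, ha _ h3⟩
end

section
/- Let n ≥ 4, let R = {±e_i ± e_j : 1 ≤ i < j ≤ n} ⊂ ℝⁿ (a root system of type D_n, with e_1,…,e_n the standard basis) and β = −e_1 − e_2. Then q(β) = 4: the sequence (e_1 + e_3, e_1 − e_3, e_2 + e_4, e_2 − e_4) is admissible for β, and there is no admissible sequence of length 5. -/
/-- The root system of type `D_n`: `{±eᵢ ± eⱼ : 1 ≤ i < j ≤ n}`. -/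
def RootD (n : ℕ) : Set (EuclideanSpace ℝ (Fin n)) :=
  {v | ∃ i j : Fin n, i ≠ j ∧
    (v = e n i + e n j ∨ v = -(e n i + e n j) ∨ v = e n i - e n j)}

theorem e_inner (n : ℕ) (i j : Fin n) : inner ℝ (e n i) (e n j) = if i = j then (1 : ℝ) else 0 := by
  simp [e, EuclideanSpace.inner_single_left]

theorem RootD_inner_self {n : ℕ} {v : EuclideanSpace ℝ (Fin n)} (hv : v ∈ RootD n) :
    inner ℝ v v = (2 : ℝ) := by
  obtain ⟨i, j, hij, rfl | rfl | rfl⟩ := hv <;>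
    simp only [inner_neg_neg, inner_add_left, inner_add_right, inner_sub_left, inner_sub_right,
      e_inner, if_neg hij, if_neg hij.symm, if_true] <;> norm_num

/-- The sum of `±eᵢ` and `±eⱼ` with `i ≠ j` is a root of `D_n`. -/
theorem add_mem_RootD {n : ℕ} {i j : Fin n} (hij : i ≠ j) {x y : EuclideanSpace ℝ (Fin n)}
    (hx : x = e n i ∨ x = -e n i) (hy : y = e n j ∨ y = -e n j) : x + y ∈ RootD n := by
  rcases hx with rfl | rfl <;> rcases hy with rfl | rfl
  · exact ⟨i, j, hij, Or.inl rfl⟩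
  · exact ⟨i, j, hij, Or.inr (Or.inr (by abel))⟩
  · exact ⟨j, i, hij.symm, Or.inr (Or.inr (by abel))⟩
  · exact ⟨i, j, hij, Or.inr (Or.inl (by abel))⟩

/-- If all elements of `R` have squared length `2`, admissible sequences have length at most `4`:
their members are pairwise orthogonal and have inner product `-1` with `β`, so that
`0 ≤ ‖β + ½ ∑ αᵢ‖² = 2 - k / 2`. -/
theorem IsAdmissible.length_le_four {V : Type*} [NormedAddCommGroup V] [InnerProductSpace ℝ V]
    {R : Set V} (hR : ∀ v ∈ R, inner ℝ v v = (2 : ℝ)) {β : V} (hβ : β ∈ R) {k : ℕ}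
    {α : Fin k → V} (h : IsAdmissible R β α) : k ≤ 4 := by
  obtain ⟨hα, -, hs⟩ := h
  have hβα (i : Fin k) : inner ℝ β (α i) = (-1 : ℝ) := by
    have h1 := hR _ (hs {i} (by simp))
    rw [Finset.sum_singleton, real_inner_add_add_self, hR _ hβ, hR _ (hα i)] at h1
    linarith
  have hαα (i j : Fin k) : inner ℝ (α i) (α j) = if i = j then (2 : ℝ) else 0 := by
    split_ifs with hij
    · rw [← hij, hR _ (hα i)]
    · have h1 := hR _ (hs {i, j} (by simp))
      rw [Finset.sum_pair hij, real_inner_add_add_self, real_inner_add_add_self, inner_add_right,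
        hR _ hβ, hR _ (hα i), hR _ (hα j), hβα, hβα] at h1
      linarith
  have hpos := real_inner_self_nonneg (x := β + (1 / 2 : ℝ) • ∑ i, α i)
  rw [real_inner_add_add_self, hR _ hβ, real_inner_smul_left, real_inner_smul_right,
    real_inner_smul_right, inner_sum, sum_inner] at hpos
  simp only [inner_sum, hβα, hαα, Finset.sum_ite_eq, Finset.mem_univ, if_true, Finset.sum_const,
    Finset.card_univ, Fintype.card_fin, nsmul_eq_mul] at hpos
  have hk : (k : ℝ) ≤ 4 := by linarith
  exact_mod_cast hk

/-- The four roots `a ± c`, `b ± d` form an admissible sequence for `-(a + b)`, where `a`, `b`,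
`c`, `d` are distinct standard basis vectors. -/
theorem isAdmissible_RootD {n : ℕ} {a b c d : Fin n} (hab : a ≠ b) (hac : a ≠ c) (had : a ≠ d)
    (hbc : b ≠ c) (hbd : b ≠ d) (hcd : c ≠ d) :
    IsAdmissible (RootD n) (-(e n a + e n b))
      ![e n a + e n c, e n a - e n c, e n b + e n d, e n b - e n d] := by
  refine ⟨?_, ?_, ?_⟩
  · intro i
    fin_cases i
    · exact ⟨a, c, hac, Or.inl rfl⟩
    · exact ⟨a, c, hac, Or.inr (Or.inr rfl)⟩
    · exact ⟨b, d, hbd, Or.inl rfl⟩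
    · exact ⟨b, d, hbd, Or.inr (Or.inr rfl)⟩
  · intro i j hij
    suffices h : ∀ v : EuclideanSpace ℝ (Fin n), inner ℝ v v = (4 : ℝ) → v ∉ RootD n ∧ v ≠ 0 by
      apply h
      fin_cases i <;> fin_cases j <;> first
        | exact absurd rfl hij
        | simp [-inner_self_eq_norm_sq_to_K, inner_add_left, inner_add_right, inner_sub_left,
            inner_sub_right, e_inner, hab, hac, had, hbc, hbd, hcd, hab.symm, hac.symm,
            had.symm, hbc.symm, hbd.symm, hcd.symm]; norm_num
    refine fun v hv => ⟨fun hmem => ?_, ?_⟩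
    · have := RootD_inner_self hmem
      linarith
    · rintro rfl
      simp at hv
  · intro s _
    have hsum : -(e n a + e n b) + ∑ i ∈ s,
        ![e n a + e n c, e n a - e n c, e n b + e n d, e n b - e n d] i =
        (-e n a + ((if 0 ∈ s then e n a + e n c else 0) +
          if 1 ∈ s then e n a - e n c else 0)) +
        (-e n b + ((if 2 ∈ s then e n b + e n d else 0) +
          if 3 ∈ s then e n b - e n d else 0)) := by
      nth_rw 1 [← Finset.univ_inter s]
      rw [← Finset.sum_ite_mem, Fin.sum_univ_four]
      simp only [Matrix.cons_val]
      abel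
    have hsplit (x y : EuclideanSpace ℝ (Fin n)) (p q : Prop) [Decidable p] [Decidable q] :
        ∃ z ∈ ({x, y} : Set (EuclideanSpace ℝ (Fin n))),
          -x + ((if p then x + y else 0) + if q then x - y else 0) = z ∨
          -x + ((if p then x + y else 0) + if q then x - y else 0) = -z := by
      by_cases hp : p <;> by_cases hq : q <;> simp only [hp, hq, if_true, if_false]
      · exact ⟨x, by simp, Or.inl (by abel)⟩
      · exact ⟨y, by simp, Or.inl (by abel)⟩
      · exact ⟨y, by simp, Or.inr (by abel)⟩
      · exact ⟨x, by simp, Or.inr (by abel)⟩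
    rw [hsum]
    obtain ⟨z, rfl | rfl, hz⟩ := hsplit (e n a) (e n c) (0 ∈ s) (1 ∈ s) <;>
      obtain ⟨w, rfl | rfl, hw⟩ := hsplit (e n b) (e n d) (2 ∈ s) (3 ∈ s)
    · exact add_mem_RootD hab hz hw
    · exact add_mem_RootD had hz hw
    · exact add_mem_RootD hbc.symm hz hw
    · exact add_mem_RootD hcd hz hw

/-- For `n ≥ 4`, in the root system of type `D_n` the root `β = −e₁ − e₂` has
`q(β) = 4`: the sequence `(e₁ + e₃, e₁ − e₃, e₂ + e₄, e₂ − e₄)` is admissible for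
`β`, and there is no admissible sequence of length `5`. -/
theorem dN_q_eq_four (n : ℕ) (hn : 4 ≤ n) :
    IsAdmissible (RootD n) (-(e n ⟨0, by omega⟩ + e n ⟨1, by omega⟩))
      ![e n ⟨0, by omega⟩ + e n ⟨2, by omega⟩,
        e n ⟨0, by omega⟩ - e n ⟨2, by omega⟩,
        e n ⟨1, by omega⟩ + e n ⟨3, by omega⟩,
        e n ⟨1, by omega⟩ - e n ⟨3, by omega⟩] ∧
      ¬ ∃ α : Fin 5 → EuclideanSpace ℝ (Fin n),
        IsAdmissible (RootD n) (-(e n ⟨0, by omega⟩ + e n ⟨1, by omega⟩)) α := by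
  refine ⟨isAdmissible_RootD ?_ ?_ ?_ ?_ ?_ ?_, fun ⟨α, hα⟩ => ?_⟩
  any_goals simp
  have := hα.length_le_four (fun _ => RootD_inner_self)
    ⟨⟨0, by omega⟩, ⟨1, by omega⟩, by simp, Or.inr (Or.inl rfl)⟩
  omega
end
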